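/- arXiv:math/0511678 — 3 statements merged into one kernel-verified Lean document; each statement's English description precedes it below -/
import Mathlib

section
/- Let φ : ℤ≥1 → ℝ be a positive, non-increasing function with φ(1) = 1, φ(q) → 0 as q → ∞, and q·φ(q) → ∞ as q → ∞. Let α be a badly approximable real number. Then there exists an uncountable set B of badly approximable real numbers such that for every β ∈ B there exist infinitely many positive integers q with q · ‖qα‖ · ‖qβ‖ ≤ 1/(q · φ(q)). In particular, for every β ∈ B, inf_{q ≥ 1} q · ‖qα‖ · ‖qβ‖ = 0. -/
open Filter Topology

/-- Distance from a real number to the nearest integer. -/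
noncomputable def nint (x : ℝ) : ℝ := |x - round x|

/-- A real number is badly approximable: `inf_{q ≥ 1} q·‖qα‖ > 0`. -/
def IsBad (α : ℝ) : Prop :=
  0 < ⨅ q : ℕ+, ((q : ℕ) : ℝ) * nint (((q : ℕ) : ℝ) * α)

/-- Denominators (continuants) of the continued fraction `[0; a 1, a 2, …]`:
`q 0 = 1`, `q 1 = a 1`, `q (j+2) = a (j+2) * q (j+1) + q j`. -/
def cfQ (a : ℕ → ℕ) : ℕ → ℕ
  | 0 => 1
  | 1 => a 1
  | n + 2 => a (n + 2) * cfQ a (n + 1) + cfQ a n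

/-- Numerators of the continued fraction `[0; a 1, a 2, …]`. -/
def cfP (a : ℕ → ℕ) : ℕ → ℕ
  | 0 => 0
  | 1 => 1
  | n + 2 => a (n + 2) * cfP a (n + 1) + cfP a n

/-- `a` (indexed from `1`) is the sequence of partial quotients of the continued
fraction expansion of `α`, i.e. `α = [0; a 1, a 2, …]`. -/
def IsCF (a : ℕ → ℕ) (α : ℝ) : Prop :=
  (∀ i, 1 ≤ i → 1 ≤ a i) ∧
    Tendsto (fun n => (cfP a n : ℝ) / (cfQ a n)) atTop (nhds α)

theorem nint_nonneg (x : ℝ) : 0 ≤ nint x := abs_nonneg _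

theorem nint_le_abs_sub (x : ℝ) (p : ℤ) : nint x ≤ |x - p| := round_le x p

theorem nint_natCast_mul_fract (q : ℕ) (α : ℝ) : nint (q * Int.fract α) = nint (q * α) := by
  have h : (q : ℝ) * Int.fract α = q * α - ((q * ⌊α⌋ : ℤ) : ℝ) := by
    rw [Int.fract]; push_cast; ring
  rw [h, nint, nint, round_sub_intCast]
  push_cast
  congr 1
  ring

theorem bddBelow_range_mul_nint (α : ℝ) :
    BddBelow (Set.range fun q : ℕ+ => ((q : ℕ) : ℝ) * nint (((q : ℕ) : ℝ) * α)) := by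
  refine ⟨0, ?_⟩
  rintro _ ⟨q, rfl⟩
  exact mul_nonneg (Nat.cast_nonneg _) (nint_nonneg _)

theorem IsBad.exists_le {α : ℝ} (h : IsBad α) :
    ∃ c > 0, ∀ q : ℕ, 1 ≤ q → c ≤ q * nint (q * α) :=
  ⟨_, h, fun q hq => ciInf_le (bddBelow_range_mul_nint α) (⟨q, hq⟩ : ℕ+)⟩

theorem isBad_of_forall_le {α c : ℝ} (hc : 0 < c)
    (h : ∀ q : ℕ, 1 ≤ q → ∀ p : ℤ, c ≤ q * |q * α - p|) : IsBad α :=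
  hc.trans_le (le_ciInf fun q => h q q.2 _)

theorem IsBad.fract {α : ℝ} (h : IsBad α) : IsBad (Int.fract α) := by
  simpa only [IsBad, nint_natCast_mul_fract] using h

theorem IsBad.irrational {α : ℝ} (h : IsBad α) : Irrational α := by
  obtain ⟨c, hc, hα⟩ := h.exists_le
  rintro ⟨r, rfl⟩
  have h1 := hα r.den r.pos
  have h2 := nint_le_abs_sub (r.den * (r : ℝ)) r.num
  have h3 : (r.den : ℝ) * (r : ℝ) = r.num := by exact_mod_cast Rat.den_mul_eq_num r
  rw [h3, sub_self, abs_zero] at h2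
  rw [h3, le_antisymm h2 (nint_nonneg _), mul_zero] at h1
  linarith

/-- Denominators of the convergents of `[0; a 0, a 1, …]`, shifted so that `den a 0 = 0`
and `den a 1 = 1`. -/
def den (a : ℕ → ℕ) : ℕ → ℕ
  | 0 => 0
  | 1 => 1
  | n + 2 => a n * den a (n + 1) + den a n

/-- Numerators of the convergents of `[0; a 0, a 1, …]`, shifted so that `num a 0 = 1`
and `num a 1 = 0`. -/
def num (a : ℕ → ℕ) : ℕ → ℕ
  | 0 => 1
  | 1 => 0
  | n + 2 => a n * num a (n + 1) + num a n

section Den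

variable {a : ℕ → ℕ}

theorem den_le_den_succ (ha : ∀ n, 1 ≤ a n) (n : ℕ) : den a n ≤ den a (n + 1) := by
  cases n with
  | zero => simp [den]
  | succ n =>
    have := Nat.le_mul_of_pos_left (den a (n + 1)) (ha n)
    simp only [den]
    omega

theorem den_succ_pos (ha : ∀ n, 1 ≤ a n) (n : ℕ) : 1 ≤ den a (n + 1) := by
  induction n with
  | zero => simp [den]
  | succ n ih => exact ih.trans (den_le_den_succ ha _)

theorem le_den_succ (ha : ∀ n, 1 ≤ a n) (n : ℕ) : n ≤ den a (n + 1) := by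
  induction n with
  | zero => simp
  | succ n ih =>
    cases n with
    | zero => exact den_succ_pos ha 1
    | succ n =>
      have h1 := den_succ_pos ha n
      have h2 := Nat.le_mul_of_pos_left (den a (n + 1 + 1)) (ha (n + 1))
      rw [den]
      omega

theorem den_succ_le {M : ℕ} (ha : ∀ n, 1 ≤ a n) (hM : ∀ n, a n ≤ M) (n : ℕ) :
    den a (n + 2) ≤ (M + 1) * den a (n + 1) := by
  have h1 := den_le_den_succ ha n
  have h2 := Nat.mul_le_mul_right (den a (n + 1)) (hM n)
  rw [den]
  linarith

theorem den_succ_le_pow {M : ℕ} (ha : ∀ n, 1 ≤ a n) (hM : ∀ n, a n ≤ M) (n : ℕ) :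
    den a (n + 1) ≤ (M + 1) ^ n := by
  induction n with
  | zero => simp [den]
  | succ n ih =>
    calc den a (n + 2) ≤ (M + 1) * den a (n + 1) := den_succ_le ha hM n
      _ ≤ (M + 1) * (M + 1) ^ n := Nat.mul_le_mul_left _ ih
      _ = (M + 1) ^ (n + 1) := by ring

/-- Mirror formula for continuants. -/
theorem den_eq_of_mirror {b : ℕ → ℕ} {N m : ℕ} (h : ∀ i j, i + j + 1 = N → j < m → b i = a j)
    (L j : ℕ) (hj : j ≤ m) (hL : L + j = N) :
    den b (N + 1) = den b (L + 1) * den a (j + 1) + den b L * den a j := by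
  induction j generalizing L with
  | zero => subst hL; simp [den]
  | succ j ih =>
    rw [ih (L + 1) (by omega) (by omega)]
    have := h L j (by omega) (by omega)
    simp only [den, this]
    ring

end Den

/-- `x` is the sequence of tails of the continued fraction `x 0 = [0; a 0, a 1, …]`. -/
structure IsExpansion (a : ℕ → ℕ) (x : ℕ → ℝ) : Prop where
  one_le : ∀ n, 1 ≤ a n
  pos : ∀ n, 0 < x n
  lt_one : ∀ n, x n < 1
  step : ∀ n, x n * (a n + x (n + 1)) = 1

namespace IsExpansion

variable {a : ℕ → ℕ} {x : ℕ → ℝ}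

theorem prod_pos (h : IsExpansion a x) (n : ℕ) : 0 < ∏ i ∈ Finset.range n, x i :=
  Finset.prod_pos fun i _ => h.pos i

theorem prod_mul_den (h : IsExpansion a x) (n : ℕ) :
    (∏ i ∈ Finset.range n, x i) * (den a (n + 1) + den a n * x n) = 1 := by
  induction n with
  | zero => simp [den]
  | succ n ih =>
    rw [Finset.prod_range_succ, den]
    push_cast
    linear_combination ih + (∏ i ∈ Finset.range n, x i) * den a (n + 1) * h.step n

theorem prod_mul_den_le (h : IsExpansion a x) (n : ℕ) :
    (∏ i ∈ Finset.range n, x i) * den a (n + 1) ≤ 1 := by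
  have h1 := h.prod_mul_den n
  have : 0 ≤ (∏ i ∈ Finset.range n, x i) * (den a n * x n) :=
    mul_nonneg (h.prod_pos n).le (mul_nonneg (Nat.cast_nonneg _) (h.pos n).le)
  linarith

theorem one_le_two_mul_prod_mul_den (h : IsExpansion a x) (n : ℕ) :
    1 ≤ 2 * ((∏ i ∈ Finset.range n, x i) * den a (n + 1)) := by
  have h1 := h.prod_mul_den n
  have h2 : (den a n : ℝ) ≤ den a (n + 1) := by exact_mod_cast den_le_den_succ h.one_le n
  have h3 : (den a n : ℝ) * x n ≤ den a (n + 1) :=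
    (mul_le_of_le_one_right (Nat.cast_nonneg _) (h.lt_one n).le).trans h2
  have := mul_le_mul_of_nonneg_left h3 (h.prod_pos n).le
  linarith

theorem error_succ (h : IsExpansion a x) (n : ℕ) :
    den a (n + 1) * x 0 - num a (n + 1) = -(x n * (den a n * x 0 - num a n)) := by
  induction n with
  | zero => simp [den, num]
  | succ n ih =>
    apply mul_left_cancel₀ (h.pos n).ne'
    simp only [den, num]
    push_cast
    linear_combination ((den a (n + 1) : ℝ) * x 0 - num a (n + 1)) * h.step n + ih

theorem abs_error (h : IsExpansion a x) (n : ℕ) :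
    |den a n * x 0 - num a n| = ∏ i ∈ Finset.range n, x i := by
  induction n with
  | zero => simp [den, num]
  | succ n ih =>
    rw [h.error_succ, abs_neg, abs_mul, ih, abs_of_pos (h.pos n), Finset.prod_range_succ, mul_comm]

theorem inv_le {M : ℕ} (h : IsExpansion a x) (hM : ∀ n, a n ≤ M) (n : ℕ) :
    1 ≤ x n * (M + 1) := by
  have h1 : (a n : ℝ) ≤ M := by exact_mod_cast hM n
  calc 1 = x n * (a n + x (n + 1)) := (h.step n).symm
    _ ≤ x n * (M + 1) := mul_le_mul_of_nonneg_left (by linarith [h.lt_one (n + 1)]) (h.pos n).le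

theorem digit_eq_floor (h : IsExpansion a x) (n : ℕ) : (a n : ℤ) = ⌊(x n)⁻¹⌋ := by
  rw [← eq_inv_of_mul_eq_one_right (h.step n), eq_comm, Int.floor_eq_iff]
  push_cast
  exact ⟨by linarith [h.pos (n + 1)], by linarith [h.lt_one (n + 1)]⟩

theorem digits_eq {b : ℕ → ℕ} {y : ℕ → ℝ} (h : IsExpansion a x) (h' : IsExpansion b y)
    (h0 : x 0 = y 0) : a = b := by
  have hxy : ∀ n, x n = y n := by
    intro n
    induction n with
    | zero => exact h0
    | succ n ih =>
      have hab : (a n : ℤ) = b n := by rw [h.digit_eq_floor, h'.digit_eq_floor, ih]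
      have h1 := eq_inv_of_mul_eq_one_right (h.step n)
      have h2 := eq_inv_of_mul_eq_one_right (h'.step n)
      have h3 : (a n : ℝ) = b n := by exact_mod_cast hab
      rw [ih, ← h2, h3] at h1
      exact add_left_cancel h1
  funext n
  have : (a n : ℤ) = b n := by rw [h.digit_eq_floor, h'.digit_eq_floor, hxy]
  exact_mod_cast this

theorem nint_den_mul_le (h : IsExpansion a x) (n : ℕ) :
    den a (n + 1) * nint (den a (n + 1) * x 0) ≤ x n := by
  have h1 := nint_le_abs_sub (den a (n + 1) * x 0) (num a (n + 1))
  rw [Int.cast_natCast, h.abs_error, Finset.prod_range_succ] at h1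
  calc _ ≤ (den a (n + 1) : ℝ) * ((∏ i ∈ Finset.range n, x i) * x n) :=
        mul_le_mul_of_nonneg_left h1 (Nat.cast_nonneg _)
    _ = (∏ i ∈ Finset.range n, x i) * den a (n + 1) * x n := by ring
    _ ≤ x n := mul_le_of_le_one_left (h.pos n).le (h.prod_mul_den_le n)

/-- A badly approximable number has bounded partial quotients. -/
theorem exists_digit_le (h : IsExpansion a x) (hx : IsBad (x 0)) : ∃ M, ∀ n, a n ≤ M := by
  obtain ⟨c, hc, hbad⟩ := hx.exists_le
  refine ⟨⌈c⁻¹⌉₊, fun n => ?_⟩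
  have h1 : c ≤ x n := (hbad _ (den_succ_pos h.one_le n)).trans (h.nint_den_mul_le n)
  have h2 : (a n : ℝ) ≤ c⁻¹ := by
    have h3 := eq_inv_of_mul_eq_one_right (h.step n)
    have h4 := inv_anti₀ hc h1
    linarith [h.pos (n + 1)]
  exact_mod_cast h2.trans (Nat.le_ceil _)

/-- A number with bounded partial quotients is badly approximable. -/
theorem isBad {M : ℕ} (h : IsExpansion a x) (hM : ∀ n, a n ≤ M) : IsBad (x 0) := by
  refine isBad_of_forall_le (c := 1 / (8 * ((M : ℝ) + 1) ^ 3)) (by positivity) fun q hq p => ?_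
  have hex : ∃ n, 2 * q ≤ den a (n + 1) := ⟨2 * q, le_den_succ h.one_le _⟩
  obtain ⟨n, hn, hmin⟩ : ∃ n, 2 * q ≤ den a (n + 2) ∧ den a (n + 1) < 2 * q := by
    obtain ⟨n, hn⟩ : ∃ n, Nat.find hex = n + 1 := by
      refine Nat.exists_eq_succ_of_ne_zero fun h0 => ?_
      have := Nat.find_spec hex
      rw [h0, zero_add, den] at this
      omega
    refine ⟨n, by simpa only [hn] using Nat.find_spec hex, ?_⟩
    exact not_le.mp (Nat.find_min hex (by omega))
  have hq0 : (0 : ℝ) < q := by exact_mod_cast hq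
  have hs2 : (den a (n + 2) : ℝ) ≤ 2 * (M + 1) * q := by
    have := (den_succ_le h.one_le hM n).trans (Nat.mul_le_mul_left (M + 1) hmin.le)
    have : den a (n + 2) ≤ 2 * (M + 1) * q := by linarith
    exact_mod_cast this
  have hs1 : 2 * (q : ℝ) ≤ den a (n + 2) := by exact_mod_cast hn
  have herr := h.abs_error (n + 2)
  rw [Finset.prod_range_succ] at herr
  have hupper := h.prod_mul_den_le (n + 1)
  have hlower := h.one_le_two_mul_prod_mul_den (n + 1)
  have hP := h.prod_pos (n + 1)
  have hx0 := h.pos (n + 1)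
  have hx1 := h.lt_one (n + 1)
  have hxM := h.inv_le hM (n + 1)
  rw [show n + 1 + 1 = n + 2 from rfl] at *
  set s := ((den a (n + 2) : ℕ) : ℝ)
  set r := ((num a (n + 2) : ℕ) : ℝ)
  set P := ∏ i ∈ Finset.range (n + 1), x i
  have hs0 : 0 < s := by linarith
  rw [div_le_iff₀ (by positivity)]
  have hid : s * (q * x 0 - p) = q * (s * x 0 - r) + (q * r - p * s) := by ring
  have hsabs : s * |q * x 0 - p| = |s * (q * x 0 - p)| := by rw [abs_mul, abs_of_pos hs0]
  by_cases hz : (q : ℝ) * r - p * s = 0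
  · have habs : s * |q * x 0 - p| = q * (P * x (n + 1)) := by
      rw [hsabs, hid, hz, add_zero, abs_mul, herr, abs_of_pos hq0]
    have h1 : 1 ≤ 2 * (M + 1) * (P * x (n + 1) * s) := by
      nlinarith [mul_pos hP hs0]
    have h2 : s ^ 2 ≤ (2 * (M + 1) * q) ^ 2 := pow_le_pow_left₀ hs0.le hs2 2
    have h3 : s ^ 2 * (q * |q * x 0 - p|) = q ^ 2 * (P * x (n + 1) * s) := by
      linear_combination s * q * habs
    have h4 : s ^ 2 * 1 ≤ s ^ 2 * (q * |q * x 0 - p| * (8 * ((M : ℝ) + 1) ^ 3)) := by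
      calc s ^ 2 * 1 ≤ (2 * (M + 1) * q) ^ 2 * 1 := by linarith
        _ ≤ (2 * (M + 1) * q) ^ 2 * (2 * (M + 1) * (P * x (n + 1) * s)) := by gcongr
        _ = _ := by linear_combination -(8 * ((M : ℝ) + 1) ^ 3) * h3
    exact le_of_mul_le_mul_left h4 (by positivity)
  · have h1 : (1 : ℝ) ≤ |q * r - p * s| := by
      have hcast : (q : ℝ) * r - p * s =
          ((q * num a (n + 2) - p * den a (n + 2) : ℤ) : ℝ) := by push_cast; rfl
      rw [hcast] at hz ⊢
      exact_mod_cast Int.one_le_abs (Int.cast_ne_zero.1 hz)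
    have h2 : |q * (s * x 0 - r)| ≤ 1 / 2 := by
      rw [abs_mul, herr, abs_of_pos hq0]
      have h3 : P * x (n + 1) * s ≤ 1 := by nlinarith [mul_pos hP hs0]
      nlinarith [mul_pos hP hx0]
    have h3 : 1 / 2 ≤ s * |q * x 0 - p| := by
      rw [hsabs, hid]
      have := abs_sub_abs_le_abs_sub ((q : ℝ) * r - p * s) (-(q * (s * x 0 - r)))
      rw [abs_neg, sub_neg_eq_add, add_comm ((q : ℝ) * r - p * s)] at this
      linarith
    have h4 : 1 / 2 ≤ 2 * (M + 1) * q * |q * x 0 - p| :=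
      h3.trans (mul_le_mul_of_nonneg_right hs2 (abs_nonneg _))
    have h5 : (M : ℝ) + 1 ≤ (M + 1) ^ 3 :=
      le_self_pow₀ (by linarith [M.cast_nonneg (α := ℝ)]) (by norm_num)
    have h6 : 0 ≤ q * |q * x 0 - p| := by positivity
    nlinarith [mul_le_mul_of_nonneg_left h5 h6]

/-- If the last `m` of the first `L + m` digits of `b` are the first `m` digits of `x 0`
in reverse order, then the corresponding denominator approximates `x 0` well. -/
theorem abs_sub_den_of_mirror (h : IsExpansion a x) {b : ℕ → ℕ} {N m : ℕ}
    (hb : ∀ i j, i + j + 1 = N → j < m → b i = a j) (L j : ℕ) (hj : j ≤ m) (hL : L + j = N) :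
    |den b (N + 1) * x 0 - den b N| =
      (∏ i ∈ Finset.range j, x i) * |den b (L + 1) * x j - den b L| := by
  induction j generalizing L with
  | zero => subst hL; simp
  | succ j ih =>
    rw [ih (L + 1) (by omega) (by omega), Finset.prod_range_succ, mul_assoc]
    congr 1
    rw [← abs_of_pos (h.pos j), ← abs_mul, abs_of_pos (h.pos j), ← abs_neg]
    congr 1
    simp only [den, hb L j (by omega) (by omega)]
    push_cast
    linear_combination -(den b (L + 1) : ℝ) * h.step j

theorem den_mul_nint_le_of_mirror (h : IsExpansion a x) {b : ℕ → ℕ} (hb1 : ∀ n, 1 ≤ b n)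
    {L m : ℕ} (hb : ∀ i j, i + j + 1 = L + m → j < m → b i = a j) :
    den b (L + m + 1) * nint (den b (L + m + 1) * x 0) ≤ 2 * (den b (L + 1) : ℝ) ^ 2 := by
  have h1 := nint_le_abs_sub (den b (L + m + 1) * x 0) (den b (L + m))
  rw [Int.cast_natCast, h.abs_sub_den_of_mirror hb L m le_rfl rfl] at h1
  have h2 : (den b (L + m + 1) : ℝ) =
      den b (L + 1) * den a (m + 1) + den b L * den a m := by
    exact_mod_cast den_eq_of_mirror hb L m le_rfl rfl
  have hbL : (den b L : ℝ) ≤ den b (L + 1) := by exact_mod_cast den_le_den_succ hb1 L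
  have haL : (den a m : ℝ) ≤ den a (m + 1) := by exact_mod_cast den_le_den_succ h.one_le m
  have h3 : (den b (L + m + 1) : ℝ) ≤ 2 * (den b (L + 1) * den a (m + 1)) := by
    rw [h2]
    have : (den b L : ℝ) * den a m ≤ den b (L + 1) * den a (m + 1) := by gcongr
    linarith
  have h4 : |den b (L + 1) * x m - den b L| ≤ den b (L + 1) := by
    have h5 : (den b (L + 1) : ℝ) * x m ≤ den b (L + 1) :=
      mul_le_of_le_one_right (Nat.cast_nonneg _) (h.lt_one m).le
    have h6 : 0 ≤ (den b (L + 1) : ℝ) * x m := mul_nonneg (Nat.cast_nonneg _) (h.pos m).le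
    rw [abs_le]
    constructor <;> linarith [(den b L).cast_nonneg (α := ℝ)]
  have hP := h.prod_pos m
  calc _ ≤ (2 * (den b (L + 1) * den a (m + 1)) : ℝ) *
        ((∏ i ∈ Finset.range m, x i) * den b (L + 1)) :=
        mul_le_mul h3 (h1.trans (mul_le_mul_of_nonneg_left h4 hP.le)) (nint_nonneg _)
          (by positivity)
    _ = 2 * (den b (L + 1) : ℝ) ^ 2 * ((∏ i ∈ Finset.range m, x i) * den a (m + 1)) := by ring
    _ ≤ 2 * (den b (L + 1) : ℝ) ^ 2 :=
        mul_le_of_le_one_right (by positivity) (h.prod_mul_den_le m)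

end IsExpansion

/-- Every irrational number in `(0, 1)` has a continued fraction expansion. -/
theorem exists_isExpansion_of_irrational {α : ℝ} (hα : Irrational α) (h0 : 0 < α) (h1 : α < 1) :
    ∃ a x, IsExpansion a x ∧ x 0 = α := by
  let x : ℕ → ℝ := fun n => (fun y => Int.fract y⁻¹)^[n] α
  have hx : ∀ n, x (n + 1) = Int.fract (x n)⁻¹ := fun n => Function.iterate_succ_apply' _ _ _
  have hirr : ∀ n, Irrational (x n) ∧ 0 < x n ∧ x n < 1 := by
    intro n
    induction n with
    | zero => exact ⟨hα, h0, h1⟩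
    | succ n ih =>
      have hfr : Irrational (Int.fract (x n)⁻¹) := ih.1.inv.sub_intCast _
      rw [hx]
      exact ⟨hfr, (Int.fract_nonneg _).lt_of_ne' hfr.ne_zero, Int.fract_lt_one _⟩
  refine ⟨fun n => ⌊(x n)⁻¹⌋₊, x, ⟨fun n => ?_, fun n => (hirr n).2.1, fun n => (hirr n).2.2,
    fun n => ?_⟩, rfl⟩
  · exact Nat.le_floor (by simpa using (one_le_inv₀ (hirr n).2.1).2 (hirr n).2.2.le)
  · rw [hx, natCast_floor_eq_intCast_floor (inv_nonneg.2 (hirr n).2.1.le), Int.floor_add_fract,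
      mul_inv_cancel₀ (hirr n).2.1.ne']

/-- Every sequence of positive integers is the sequence of partial quotients of some number. -/
theorem exists_isExpansion {b : ℕ → ℕ} (hb : ∀ n, 1 ≤ b n) : ∃ y, IsExpansion b y := by
  let S : ℕ → Set (ℕ → ℝ) := fun N =>
    Set.univ.pi (fun _ => Set.Icc 0 1) ∩ {y | ∀ n < N, y n * (b n + y (n + 1)) = 1}
  have hpi : IsCompact (Set.univ.pi fun _ : ℕ => Set.Icc (0 : ℝ) 1) :=
    isCompact_univ_pi fun _ => isCompact_Icc
  have hclosed : ∀ N, IsClosed {y : ℕ → ℝ | ∀ n < N, y n * (b n + y (n + 1)) = 1} := by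
    intro N
    simp only [Set.ofPred_forall]
    exact isClosed_iInter fun n => isClosed_iInter fun _ =>
      isClosed_eq (by fun_prop) continuous_const
  have hne : ∀ (N : ℕ) (b : ℕ → ℕ), (∀ n, 1 ≤ b n) →
      ∃ y : ℕ → ℝ, (∀ n, 0 ≤ y n ∧ y n ≤ 1) ∧ ∀ n < N, y n * (b n + y (n + 1)) = 1 := by
    intro N
    induction N with
    | zero => exact fun b _ => ⟨0, by simp, by simp⟩
    | succ N ih =>
      intro b hb
      obtain ⟨y, hy, hrec⟩ := ih (fun n => b (n + 1)) fun n => hb _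
      have hb0 : (1 : ℝ) ≤ b 0 := by exact_mod_cast hb 0
      have hpos : 1 ≤ b 0 + y 0 := by linarith [(hy 0).1]
      refine ⟨fun n => n.casesOn ((b 0 + y 0)⁻¹) y, fun n => ?_, fun n hn => ?_⟩
      · cases n with
        | zero => exact ⟨inv_nonneg.2 (by linarith), inv_le_one_of_one_le₀ hpos⟩
        | succ n => exact hy n
      · cases n with
        | zero => exact inv_mul_cancel₀ (by linarith)
        | succ n => exact hrec n (by omega)
  obtain ⟨y, hy⟩ : (⋂ N, S N).Nonempty := by
    refine IsCompact.nonempty_iInter_of_sequence_nonempty_isCompact_isClosed S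
      (fun N => ?_) (fun N => ?_) (hpi.inter_right (hclosed 0))
      (fun N => hpi.isClosed.inter (hclosed N))
    · exact Set.inter_subset_inter_right _ fun y hy n hn => hy n (by omega)
    · obtain ⟨y, hy, hrec⟩ := hne N b hb
      exact ⟨y, fun n _ => hy n, hrec⟩
  rw [Set.mem_iInter] at hy
  have hmem : ∀ n, 0 ≤ y n ∧ y n ≤ 1 := fun n => (hy 0).1 n trivial
  have hstep : ∀ n, y n * (b n + y (n + 1)) = 1 := fun n => (hy (n + 1)).2 n n.lt_succ_self
  have hpos : ∀ n, 0 < y n := fun n =>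
    (hmem n).1.lt_of_ne fun h0 => by simpa [← h0] using hstep n
  refine ⟨y, hb, hpos, fun n => ?_, hstep⟩
  have hbn : (1 : ℝ) ≤ b n := by exact_mod_cast hb n
  nlinarith [hpos n, hpos (n + 1), hstep n, mul_pos (hpos n) (hpos (n + 1))]

/-- The digit sequence cut into blocks by the strictly increasing sequence `L`: the block
`[L k, L (k + 1))` consists of an initial segment of `a` in reverse order followed by `t k`. -/
theorem exists_mirror_blocks (a t L : ℕ → ℕ) (hL : StrictMono L) :
    ∃ b : ℕ → ℕ, (∀ i, (∃ j, b i = a j) ∨ ∃ k, b i = t k) ∧ (∀ k, b (L (k + 1) - 1) = t k) ∧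
      ∀ k i j, L k ≤ i → i + j + 2 = L (k + 1) → b i = a j := by
  have hex : ∀ i, ∃ k, i < L (k + 1) := fun i => ⟨i, hL.id_le (i + 1)⟩
  have hfind : ∀ k i, L k ≤ i → i < L (k + 1) → Nat.find (hex i) = k := by
    intro k i h1 h2
    rw [Nat.find_eq_iff]
    exact ⟨h2, fun j hj => not_lt.2 ((hL.monotone hj).trans h1)⟩
  refine ⟨fun i => if i + 1 = L (Nat.find (hex i) + 1) then t (Nat.find (hex i))
    else a (L (Nat.find (hex i) + 1) - 2 - i), fun i => ?_, fun k => ?_, fun k i j h1 h2 => ?_⟩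
  · dsimp only
    split_ifs
    · exact Or.inr ⟨_, rfl⟩
    · exact Or.inl ⟨_, rfl⟩
  · have hlt := hL k.lt_succ_self
    simp only [Nat.succ_eq_add_one] at hlt
    simp only [hfind k (L (k + 1) - 1) (by omega) (by omega)]
    exact if_pos (by omega)
  · simp only [hfind k i h1 (by omega)]
    rw [if_neg (by omega)]
    congr 1
    omega

theorem iInf_eq_zero_of_infinite {φ : ℕ → ℝ}
    (hφ : Tendsto (fun q : ℕ => (q : ℝ) * φ q) atTop atTop) {α β : ℝ}
    (h : {q : ℕ | 1 ≤ q ∧ (q : ℝ) * nint ((q : ℝ) * α) * nint ((q : ℝ) * β)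
      ≤ 1 / ((q : ℝ) * φ q)}.Infinite) :
    (⨅ q : ℕ+, ((q : ℕ) : ℝ) * nint (((q : ℕ) : ℝ) * α) * nint (((q : ℕ) : ℝ) * β)) = 0 := by
  have hnonneg : ∀ q : ℕ+,
      0 ≤ ((q : ℕ) : ℝ) * nint (((q : ℕ) : ℝ) * α) * nint (((q : ℕ) : ℝ) * β) := fun q =>
    mul_nonneg (mul_nonneg (Nat.cast_nonneg _) (nint_nonneg _)) (nint_nonneg _)
  refine le_antisymm (le_of_forall_pos_le_add fun ε hε => ?_) (Real.iInf_nonneg hnonneg)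
  have hlim : Tendsto (fun q : ℕ => 1 / ((q : ℝ) * φ q)) atTop (𝓝 0) :=
    tendsto_const_nhds.div_atTop hφ
  obtain ⟨q, ⟨hq1, hq⟩, hqε⟩ :=
    ((Nat.frequently_atTop_iff_infinite.2 h).and_eventually (hlim.eventually_lt_const hε)).exists
  refine (ciInf_le ⟨0, ?_⟩ (⟨q, hq1⟩ : ℕ+)).trans ((hq.trans hqε.le).trans_eq (zero_add ε).symm)
  rintro _ ⟨q, rfl⟩
  exact hnonneg q

/-- Theorem 1 of Adamczewski–Bugeaud.  For any positive,
non-increasing `φ` with `φ 1 = 1`, `φ q → 0` and `q·φ q → ∞`, and any badly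
approximable `α`, there is an uncountable set `B` of badly approximable numbers
such that for every `β ∈ B` there are infinitely many positive integers `q`
with `q·‖qα‖·‖qβ‖ ≤ 1/(q·φ q)`; in particular `inf_{q ≥ 1} q·‖qα‖·‖qβ‖ = 0`. -/
theorem littlewood_strong_of_bad
    (φ : ℕ → ℝ)
    (hφpos : ∀ q, 1 ≤ q → 0 < φ q)
    (hφanti : ∀ p q, 1 ≤ p → p ≤ q → φ q ≤ φ p)
    (hφone : φ 1 = 1)
    (hφzero : Tendsto φ atTop (nhds 0))
    (hφinfty : Tendsto (fun q : ℕ => (q : ℝ) * φ q) atTop atTop)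
    (α : ℝ) (hα : IsBad α) :
    ∃ B : Set ℝ, ¬ B.Countable ∧ (∀ β ∈ B, IsBad β) ∧
      ∀ β ∈ B,
        {q : ℕ | 1 ≤ q ∧
            (q : ℝ) * nint ((q : ℝ) * α) * nint ((q : ℝ) * β)
              ≤ 1 / ((q : ℝ) * φ q)}.Infinite ∧
        (⨅ q : ℕ+, ((q : ℕ) : ℝ) * nint (((q : ℕ) : ℝ) * α) *
            nint (((q : ℕ) : ℝ) * β)) = 0 := by
  obtain ⟨a, x, hx, hx0⟩ := exists_isExpansion_of_irrational hα.fract.irrational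
    ((Int.fract_nonneg α).lt_of_ne' hα.fract.irrational.ne_zero) (Int.fract_lt_one α)
  obtain ⟨M₀, hM₀⟩ := hx.exists_digit_le (hx0 ▸ hα.fract)
  set M := max M₀ 2
  have hg : ∀ L : ℕ, ∃ m : ℕ, ∀ q ≥ m, 2 * (((M : ℝ) + 1) ^ L) ^ 2 * φ q ≤ 1 := by
    intro L
    have h1 := hφzero.const_mul (2 * (((M : ℝ) + 1) ^ L) ^ 2)
    rw [mul_zero] at h1
    exact eventually_atTop.1 (h1.eventually_le_const one_pos)
  choose g hg using hg
  let L : ℕ → ℕ := fun k => (fun l => l + g l + 1)^[k] 0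
  have hL : ∀ k, L (k + 1) = L k + g (L k) + 1 := fun k => Function.iterate_succ_apply' _ _ _
  have hLmono : StrictMono L := strictMono_nat_of_lt_succ fun k => by rw [hL]; omega
  choose b hb hbt hba using fun t : ℕ → Bool =>
    exists_mirror_blocks a (fun k => (t k).toNat + 1) L hLmono
  have hb1 : ∀ t n, 1 ≤ b t n := by
    intro t n
    obtain ⟨j, hj⟩ | ⟨k, hk⟩ := hb t n
    · exact hj ▸ hx.one_le j
    · omega
  have hbM : ∀ t n, b t n ≤ M := by
    intro t n
    obtain ⟨j, hj⟩ | ⟨k, hk⟩ := hb t n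
    · exact hj ▸ (hM₀ j).trans (le_max_left _ _)
    · have := (t k).toNat_le
      exact (show b t n ≤ 2 by omega).trans (le_max_right _ _)
  choose y hy using fun t => exists_isExpansion (hb1 t)
  have hinj : Function.Injective fun t => y t 0 := by
    intro t t' htt'
    have hbb : b t = b t' := (hy t).digits_eq (hy t') htt'
    funext k
    have h1 := hbt t k
    rw [hbb, hbt t' k] at h1
    cases ht : t k <;> cases ht' : t' k <;> simp_all
  refine ⟨Set.range fun t => y t 0, fun hcount => ?_, ?_, ?_⟩
  · have hunc : Uncountable (ℕ → Bool) := by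
      rw [← Cardinal.aleph0_lt_mk_iff]
      simpa using Cardinal.aleph0_lt_continuum
    exact hunc.not_countable ((Equiv.ofInjective _ hinj).countable_iff.2 hcount.to_subtype)
  · rintro _ ⟨t, rfl⟩
    exact (hy t).isBad (hbM t)
  · rintro _ ⟨t, rfl⟩
    refine (fun h => ⟨h, iInf_eq_zero_of_infinite hφinfty h⟩) ?_
    refine Set.infinite_of_forall_exists_gt fun n => ?_
    have hLn : n < L (n + 1) := hLmono.id_le (n + 1)
    set l := L (n + 1) with hl
    set q := den (b t) (l + g l + 1) with hq
    have hlq : l + g l ≤ q := le_den_succ (hb1 t) _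
    refine ⟨q, ⟨den_succ_pos (hb1 t) _, ?_⟩, by omega⟩
    have hα' : (q : ℝ) * nint (q * α) ≤ 2 * (((M : ℝ) + 1) ^ l) ^ 2 := by
      rw [← nint_natCast_mul_fract, ← hx0]
      refine (hx.den_mul_nint_le_of_mirror (hb1 t) fun i j hij hj =>
        hba t (n + 1) i j (by omega) (by rw [hL, ← hl]; omega)).trans ?_
      have : (den (b t) (l + 1) : ℝ) ≤ ((M : ℝ) + 1) ^ l := by
        exact_mod_cast den_succ_le_pow (hb1 t) (hbM t) l
      gcongr
    have hβ : (q : ℝ) * nint (q * y t 0) ≤ 1 :=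
      ((hy t).nint_den_mul_le (l + g l)).trans ((hy t).lt_one _).le
    have hq1 : 1 ≤ q := den_succ_pos (hb1 t) _
    have hq0 : (0 : ℝ) < q := by exact_mod_cast hq1
    have hφq := hφpos q hq1
    rw [le_div_iff₀ (mul_pos hq0 hφq)]
    calc (q : ℝ) * nint (q * α) * nint (q * y t 0) * (q * φ q)
        = (q : ℝ) * nint (q * α) * φ q * (q * nint (q * y t 0)) := by ring
      _ ≤ 2 * (((M : ℝ) + 1) ^ l) ^ 2 * φ q * 1 := by
          refine mul_le_mul (mul_le_mul_of_nonneg_right hα' hφq.le) hβ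
            (mul_nonneg hq0.le (nint_nonneg _)) (by positivity)
      _ ≤ 1 := by rw [mul_one]; exact hg l q (by omega)
end

section
/- Let φ : ℤ≥1 → ℝ be a positive, non-increasing function with φ(1) = 1, φ(q) → 0 as q → ∞, and q·φ(q) → ∞ as q → ∞. Let M be a positive real number and let 𝒜 be a countable set of badly approximable real numbers all of whose partial quotients are bounded by M. Then there exists an uncountable set B of badly approximable real numbers such that for every α ∈ 𝒜 and every β ∈ B there exist infinitely many positive integers q with q · ‖qα‖ · ‖qβ‖ ≤ 1/(q · φ(q)). -/
open Filter Topology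

lemma nint_le (x : ℝ) (m : ℤ) : nint x ≤ |x - m| := round_le x m

section Continuants

variable {a b : ℕ → ℕ} {α : ℝ} {N : ℕ}

lemma cfQ_pos_and_le_succ (h : ∀ i, 1 ≤ i → 1 ≤ a i) (n : ℕ) :
    0 < cfQ a n ∧ cfQ a n ≤ cfQ a (n + 1) := by
  induction n with
  | zero => simpa [cfQ] using h 1 le_rfl
  | succ n ih =>
    have h2 := h (n + 2) (by omega)
    refine ⟨by omega, ?_⟩
    simp only [cfQ]
    nlinarith

lemma cfQ_pos (h : ∀ i, 1 ≤ i → 1 ≤ a i) (n : ℕ) : 0 < cfQ a n :=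
  (cfQ_pos_and_le_succ h n).1

lemma cfQ_le_succ (h : ∀ i, 1 ≤ i → 1 ≤ a i) (n : ℕ) : cfQ a n ≤ cfQ a (n + 1) :=
  (cfQ_pos_and_le_succ h n).2

lemma le_cfQ (h : ∀ i, 1 ≤ i → 1 ≤ a i) (n : ℕ) : n ≤ cfQ a n := by
  induction n with
  | zero => simp
  | succ n ih =>
    cases n with
    | zero => simpa [cfQ] using h 1 le_rfl
    | succ n =>
      have h2 := h (n + 2) (by omega)
      have h3 := cfQ_pos h n
      simp only [cfQ] at ih ⊢
      nlinarith

lemma cfQ_succ_le_mul (h : ∀ i, 1 ≤ i → 1 ≤ a i) (hN : ∀ i, 1 ≤ i → a i ≤ N) (n : ℕ) :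
    cfQ a (n + 1) ≤ (N + 1) * cfQ a n := by
  cases n with
  | zero =>
    have := hN 1 le_rfl
    simp only [cfQ]
    omega
  | succ n =>
    have h1 := hN (n + 2) (by omega)
    have h2 := cfQ_le_succ h n
    simp only [cfQ]
    nlinarith

lemma cfQ_le_pow (h : ∀ i, 1 ≤ i → 1 ≤ a i) (hN : ∀ i, 1 ≤ i → a i ≤ N) (n : ℕ) :
    cfQ a n ≤ (N + 1) ^ n := by
  induction n with
  | zero => simp [cfQ]
  | succ n ih =>
    calc cfQ a (n + 1) ≤ (N + 1) * cfQ a n := cfQ_succ_le_mul h hN n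
      _ ≤ (N + 1) * (N + 1) ^ n := by gcongr
      _ = (N + 1) ^ (n + 1) := by ring

/-- If `b` reads `a (n + 1), …, a 1` after position `r + 1`, the continuant splits. -/
lemma cfQ_mirror (n r : ℕ) (hb : ∀ i, 1 ≤ i → i ≤ n + 1 → b (r + 1 + i) = a (n + 2 - i)) :
    cfQ b (r + 1 + (n + 1)) =
      cfQ b (r + 1) * cfQ a (n + 1) + cfQ b r * cfQ a n := by
  induction n generalizing r with
  | zero =>
    have := hb 1 le_rfl le_rfl
    simp only [cfQ]
    rw [show r + 2 = r + 1 + 1 by ring, this]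
    simp
    ring
  | succ n ih =>
    have h1 := hb 1 le_rfl (by omega)
    have h2 := ih (r + 1) (fun i hi hi' => by
      rw [show r + 1 + 1 + i = r + 1 + (i + 1) by ring, hb (i + 1) (by omega) (by omega)]
      congr 1
      omega)
    rw [show r + 1 + (n + 1 + 1) = r + 1 + 1 + (n + 1) by ring, h2]
    simp only [cfQ]
    rw [show r + 2 = r + 1 + 1 by ring, h1]
    simp
    ring

/-- The cross determinant of the `n`-th and `m`-th convergents, normalised to be nonnegative
for `n ≤ m`. -/
def cfD (a : ℕ → ℕ) (n m : ℕ) : ℤ :=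
  (-1) ^ n * ((cfQ a n : ℤ) * cfP a m - cfP a n * cfQ a m)

lemma cfD_add_two (n m : ℕ) :
    cfD a n (m + 2) = a (m + 2) * cfD a n (m + 1) + cfD a n m := by
  simp only [cfD, cfP, cfQ]
  push_cast
  ring

lemma cfD_self (n : ℕ) : cfD a n n = 0 := by
  simp only [cfD]
  ring

lemma cfD_succ (n : ℕ) : cfD a n (n + 1) = 1 := by
  induction n with
  | zero => simp [cfD, cfP, cfQ]
  | succ n ih =>
    rw [← ih]
    simp only [cfD, cfP, cfQ]
    push_cast
    ring

lemma cfD_nonneg_and_mul_le (n k : ℕ) :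
    (0 ≤ cfD a n (n + k) ∧ cfD a n (n + k) * cfQ a (n + 1) ≤ cfQ a (n + k)) ∧
    (0 ≤ cfD a n (n + k + 1) ∧
      cfD a n (n + k + 1) * cfQ a (n + 1) ≤ cfQ a (n + k + 1)) := by
  induction k with
  | zero => simp [cfD_self, cfD_succ]
  | succ k ih =>
    obtain ⟨⟨h1, h2⟩, h3, h4⟩ := ih
    refine ⟨⟨h3, h4⟩, ?_⟩
    rw [show n + (k + 1) + 1 = n + k + 2 by ring, cfD_add_two]
    refine ⟨by positivity, ?_⟩
    simp only [cfQ] at *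
    push_cast
    have : (0 : ℤ) ≤ a (n + k + 2) := by positivity
    nlinarith

lemma le_cfD_mul (h : ∀ i, 1 ≤ i → 1 ≤ a i) (n k : ℕ) :
    ((cfQ a (n + k + 1) : ℤ) ≤ cfD a n (n + k + 1) * (cfQ a (n + 1) + cfQ a n)) ∧
    ((cfQ a (n + k + 2) : ℤ) ≤ cfD a n (n + k + 2) * (cfQ a (n + 1) + cfQ a n)) := by
  induction k with
  | zero =>
    have : (1 : ℤ) ≤ a (n + 2) := by exact_mod_cast h (n + 2) (by omega)
    simp only [add_zero, cfD_add_two, cfD_self, cfD_succ, cfQ]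
    push_cast
    refine ⟨by nlinarith, by nlinarith⟩
  | succ k ih =>
    obtain ⟨h1, h2⟩ := ih
    refine ⟨h2, ?_⟩
    rw [show n + (k + 1) + 2 = n + k + 1 + 2 by ring, cfD_add_two]
    have : (0 : ℤ) ≤ a (n + k + 1 + 2) := by positivity
    rw [show cfQ a (n + k + 1 + 2) =
      a (n + k + 1 + 2) * cfQ a (n + k + 2) + cfQ a (n + k + 1) from rfl]
    rw [show n + k + 1 + 1 = n + k + 2 by ring]
    push_cast
    nlinarith

lemma abs_cfQ_mul_div_sub (h : ∀ i, 1 ≤ i → 1 ≤ a i) (n k : ℕ) :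
    |(cfQ a n : ℝ) * (cfP a (n + k) / cfQ a (n + k)) - cfP a n| =
      cfD a n (n + k) / cfQ a (n + k) := by
  have hq : (0 : ℝ) < cfQ a (n + k) := by exact_mod_cast cfQ_pos h _
  have hD : (0 : ℝ) ≤ cfD a n (n + k) := by exact_mod_cast (cfD_nonneg_and_mul_le n k).1.1
  have : (cfQ a n : ℝ) * (cfP a (n + k) / cfQ a (n + k)) - cfP a n =
      (-1) ^ n * (cfD a n (n + k) / cfQ a (n + k)) := by
    have h1 : ((-1 : ℝ) ^ n) * (-1) ^ n = 1 := by rw [← mul_pow]; simp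
    simp only [cfD]
    push_cast
    field_simp
    linear_combination (-(cfQ a n * cfP a (n + k) - cfP a n * cfQ a (n + k) : ℝ)) * h1
  rw [this, abs_mul, abs_pow, abs_neg, abs_one, one_pow, one_mul, abs_of_nonneg (by positivity)]

lemma abs_cfQ_mul_div_sub_le (h : ∀ i, 1 ≤ i → 1 ≤ a i) (n k : ℕ) :
    |(cfQ a n : ℝ) * (cfP a (n + k) / cfQ a (n + k)) - cfP a n| ≤ 1 / cfQ a (n + 1) := by
  have hq : (0 : ℝ) < cfQ a (n + k) := by exact_mod_cast cfQ_pos h _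
  have hq' : (0 : ℝ) < cfQ a (n + 1) := by exact_mod_cast cfQ_pos h _
  rw [abs_cfQ_mul_div_sub h, div_le_div_iff₀ hq hq', one_mul]
  exact_mod_cast (cfD_nonneg_and_mul_le n k).1.2

lemma tendsto_cfQ_mul_div_sub (hα : IsCF a α) (n : ℕ) :
    Tendsto (fun k => |(cfQ a n : ℝ) * (cfP a (n + k) / cfQ a (n + k)) - cfP a n|) atTop
      (𝓝 |cfQ a n * α - cfP a n|) := by
  have h := hα.2.comp (tendsto_add_atTop_nat n)
  have h' : Tendsto (fun k => (cfP a (n + k) : ℝ) / cfQ a (n + k)) atTop (𝓝 α) := by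
    refine h.congr fun k => ?_
    simp [add_comm]
  exact ((h'.const_mul _).sub_const _).abs

lemma IsCF.abs_sub_le (hα : IsCF a α) (n : ℕ) :
    |cfQ a n * α - cfP a n| ≤ 1 / cfQ a (n + 1) :=
  le_of_tendsto (tendsto_cfQ_mul_div_sub hα n)
    (Eventually.of_forall fun k => abs_cfQ_mul_div_sub_le hα.1 n k)

lemma IsCF.le_abs_sub (hα : IsCF a α) (n : ℕ) :
    1 / ((cfQ a (n + 1) : ℝ) + cfQ a n) ≤ |cfQ a n * α - cfP a n| := by
  refine ge_of_tendsto (tendsto_cfQ_mul_div_sub hα n) ?_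
  filter_upwards [eventually_ge_atTop 1] with k hk
  obtain ⟨k, rfl⟩ := Nat.exists_eq_add_of_le' hk
  have hq : (0 : ℝ) < cfQ a (n + (k + 1)) := by exact_mod_cast cfQ_pos hα.1 _
  have hq' : (0 : ℝ) < cfQ a (n + 1) := by exact_mod_cast cfQ_pos hα.1 _
  rw [abs_cfQ_mul_div_sub hα.1, div_le_div_iff₀ (by positivity) hq, one_mul]
  exact_mod_cast (le_cfD_mul hα.1 n k).1

lemma tendsto_one_div_cfQ (h : ∀ i, 1 ≤ i → 1 ≤ a i) :
    Tendsto (fun n => 1 / (cfQ a n : ℝ)) atTop (𝓝 0) := by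
  have h1 : Tendsto (fun n => (cfQ a n : ℝ)) atTop atTop :=
    tendsto_atTop_mono (fun n => by exact_mod_cast le_cfQ h n) tendsto_natCast_atTop_atTop
  simp only [one_div]
  exact h1.inv_tendsto_atTop

lemma exists_isCF (h : ∀ i, 1 ≤ i → 1 ≤ a i) : ∃ α, IsCF a α := by
  have key : ∀ n k, |(cfP a (n + k) / cfQ a (n + k) : ℝ) - cfP a n / cfQ a n| ≤
      1 / cfQ a n := by
    intro n k
    have hq : (0 : ℝ) < cfQ a n := by exact_mod_cast cfQ_pos h _
    have hq1 : (1 : ℝ) ≤ cfQ a (n + 1) := by exact_mod_cast cfQ_pos h _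
    have h1 := (abs_cfQ_mul_div_sub_le h n k).trans
      ((div_le_one (by positivity)).2 hq1)
    rw [show (cfP a (n + k) / cfQ a (n + k) : ℝ) - cfP a n / cfQ a n =
      ((cfQ a n : ℝ) * (cfP a (n + k) / cfQ a (n + k)) - cfP a n) / cfQ a n by
        field_simp, abs_div, abs_of_pos hq]
    gcongr
  have hc : CauchySeq fun n => (cfP a n : ℝ) / cfQ a n := by
    refine cauchySeq_of_le_tendsto_0' (fun n => 1 / (cfQ a n : ℝ)) (fun n m hnm => ?_)
      (tendsto_one_div_cfQ h)
    obtain ⟨k, rfl⟩ := Nat.exists_eq_add_of_le hnm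
    rw [dist_comm, Real.dist_eq]
    exact key n k
  obtain ⟨α, hα⟩ := cauchySeq_tendsto_of_complete hc
  exact ⟨α, h, hα⟩

lemma IsCF.le_mul_abs_sub (hα : IsCF a α) (hN : ∀ i, 1 ≤ i → a i ≤ N) {q : ℕ} (hq : 1 ≤ q)
    (p : ℤ) : 1 / (4 * (N + 2 : ℝ)) ≤ q * |q * α - p| := by
  have hex : ∃ n, 2 * q ≤ cfQ a (n + 1) :=
    ⟨2 * q, (Nat.le_succ _).trans (le_cfQ hα.1 _)⟩
  classical
  obtain ⟨n, hn, hmin⟩ : ∃ n, 2 * q ≤ cfQ a (n + 1) ∧ cfQ a n ≤ 2 * q := by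
    refine ⟨Nat.find hex, Nat.find_spec hex, ?_⟩
    rcases hk : Nat.find hex with _ | k
    · simp only [cfQ]; omega
    · exact (not_le.1 (Nat.find_min hex (m := k) (by omega))).le
  have hq0 : (1 : ℝ) ≤ q := by exact_mod_cast hq
  have hQ : (0 : ℝ) < cfQ a n := by exact_mod_cast cfQ_pos hα.1 n
  have hQ' : (0 : ℝ) < cfQ a (n + 1) := by exact_mod_cast cfQ_pos hα.1 (n + 1)
  have hnR : 2 * (q : ℝ) ≤ cfQ a (n + 1) := by exact_mod_cast hn
  have hminR : (cfQ a n : ℝ) ≤ 2 * q := by exact_mod_cast hmin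
  have hsucc : (cfQ a (n + 1) : ℝ) ≤ (N + 1) * cfQ a n := by
    exact_mod_cast cfQ_succ_le_mul hα.1 hN n
  have hsplit : (cfQ a n : ℝ) * (q * α - p) =
      q * (cfQ a n * α - cfP a n) + ((q * cfP a n - p * cfQ a n : ℤ) : ℝ) := by
    push_cast
    ring
  have hub : q * |cfQ a n * α - cfP a n| ≤ 1 / 2 := by
    refine (mul_le_mul_of_nonneg_left (hα.abs_sub_le n) (by positivity)).trans ?_
    rw [mul_one_div, div_le_div_iff₀ hQ' (by norm_num)]
    linarith
  have hlb : 1 / ((N + 2) * cfQ a n) ≤ |cfQ a n * α - cfP a n| := by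
    refine le_trans ?_ (hα.le_abs_sub n)
    gcongr
    linarith
  have main : 1 / (2 * (N + 2 : ℝ)) ≤ cfQ a n * |q * α - p| := by
    rw [← Nat.abs_cast (cfQ a n), ← abs_mul, hsplit]
    by_cases he : (q * cfP a n - p * cfQ a n : ℤ) = 0
    · rw [he, Int.cast_zero, add_zero, abs_mul, abs_of_nonneg (by positivity)]
      calc 1 / (2 * (N + 2 : ℝ)) ≤ q * (1 / ((N + 2) * cfQ a n)) := by
            rw [mul_one_div, div_le_div_iff₀ (by positivity) (by positivity)]
            have : (0 : ℝ) ≤ N + 2 := by positivity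
            nlinarith
        _ ≤ _ := by gcongr
    · have h1 : (1 : ℝ) ≤ |((q * cfP a n - p * cfQ a n : ℤ) : ℝ)| := by
        exact_mod_cast Int.one_le_abs he
      have h2 := abs_sub_abs_le_abs_sub ((q * cfP a n - p * cfQ a n : ℤ) : ℝ)
        (-(q * (cfQ a n * α - cfP a n)))
      rw [abs_neg, abs_mul, abs_of_nonneg (by positivity : (0 : ℝ) ≤ q), sub_neg_eq_add,
        add_comm _ (q * _ : ℝ)] at h2
      have h3 : 1 / (2 * (N + 2 : ℝ)) ≤ 1 / 2 := by
        gcongr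
        linarith [(Nat.cast_nonneg N : (0 : ℝ) ≤ N)]
      linarith
  calc 1 / (4 * (N + 2 : ℝ)) = 1 / (2 * (N + 2 : ℝ)) / 2 := by rw [div_div]; ring
    _ ≤ cfQ a n * |q * α - p| / 2 := by gcongr
    _ ≤ q * |q * α - p| := by nlinarith [abs_nonneg (q * α - p)]

lemma IsCF.isBad (hα : IsCF a α) (hN : ∀ i, 1 ≤ i → a i ≤ N) : IsBad α :=
  lt_of_lt_of_le (by positivity : (0 : ℝ) < 1 / (4 * (N + 2 : ℝ)))
    (le_ciInf fun q => hα.le_mul_abs_sub hN (by exact_mod_cast q.pos) _)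

lemma cfQ_cfP_shift (n : ℕ) :
    cfP a (n + 1) = cfQ (fun i => a (i + 1)) n ∧
      cfQ a (n + 1) = a 1 * cfQ (fun i => a (i + 1)) n + cfP (fun i => a (i + 1)) n := by
  induction n using Nat.twoStepInduction with
  | zero => simp [cfP, cfQ]
  | one => simp [cfP, cfQ, mul_comm]
  | more n h1 h2 =>
    rw [show cfP a (n + 2 + 1) = a (n + 3) * cfP a (n + 1 + 1) + cfP a (n + 1) from rfl,
      show cfQ a (n + 2 + 1) = a (n + 3) * cfQ a (n + 1 + 1) + cfQ a (n + 1) from rfl,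
      h1.1, h1.2, h2.1, h2.2]
    simp only [cfP, cfQ, true_and]
    ring

lemma IsCF.nonneg (hα : IsCF a α) : 0 ≤ α :=
  ge_of_tendsto hα.2 (Eventually.of_forall fun _ => by positivity)

lemma IsCF.pos (hα : IsCF a α) : 0 < α := by
  have h0 : (0 : ℝ) < cfQ a (0 + 1) := by exact_mod_cast cfQ_pos hα.1 _
  have h : (0 : ℝ) < 1 / ((cfQ a (0 + 1) : ℝ) + cfQ a 0) := by positivity
  have h' := h.trans_le (hα.le_abs_sub 0)
  simp only [cfQ, cfP, Nat.cast_one, one_mul, Nat.cast_zero, sub_zero] at h'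
  exact hα.nonneg.lt_of_ne (abs_pos.1 h').symm

lemma IsCF.shift (hα : IsCF a α) : IsCF (fun i => a (i + 1)) (1 / α - a 1) := by
  refine ⟨fun i _ => hα.1 _ (by omega), ?_⟩
  have h := ((hα.2.comp (tendsto_add_atTop_nat 1)).inv₀ hα.pos.ne').sub_const (a 1 : ℝ)
  rw [one_div]
  refine h.congr fun n => ?_
  have h1 : (0 : ℝ) < cfQ (fun i => a (i + 1)) n := by
    exact_mod_cast cfQ_pos (fun i _ => hα.1 _ (by omega)) n
  simp only [Function.comp, (cfQ_cfP_shift n).1, (cfQ_cfP_shift n).2, Nat.cast_add, Nat.cast_mul]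
  field_simp
  ring

lemma IsCF.lt_one (hα : IsCF a α) : α < 1 := by
  have h1 := hα.shift.pos
  have h2 : (1 : ℝ) ≤ a 1 := by exact_mod_cast hα.1 1 le_rfl
  exact (one_lt_div hα.pos).1 (by linarith)

lemma IsCF.floor_one_div (hα : IsCF a α) : ⌊1 / α⌋ = a 1 := by
  rw [Int.floor_eq_iff]
  push_cast
  constructor <;> linarith [hα.shift.pos, hα.shift.lt_one]

lemma IsCF.unique (ha : IsCF a α) (hb : IsCF b α) (i : ℕ) : a (i + 1) = b (i + 1) := by
  induction i generalizing a b α with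
  | zero => exact_mod_cast ha.floor_one_div.symm.trans hb.floor_one_div
  | succ i ih =>
    have h1 : a 1 = b 1 := by exact_mod_cast ha.floor_one_div.symm.trans hb.floor_one_div
    have h2 := hb.shift
    rw [← h1] at h2
    exact ih ha.shift h2

/-- A mirrored block in `β` makes its last convergent denominator a good simultaneous
denominator for `α` and `β`. -/
lemma IsCF.mul_nint_mul_nint_le {β : ℝ} (hα : IsCF a α) (hβ : IsCF b β) (n r : ℕ)
    (hb : ∀ i, 1 ≤ i → i ≤ n + 1 → b (r + 1 + i) = a (n + 2 - i)) :
    (cfQ b (r + 1 + (n + 1)) : ℝ) * nint (cfQ b (r + 1 + (n + 1)) * α) *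
        nint (cfQ b (r + 1 + (n + 1)) * β) ≤
      4 * (cfQ b (r + 1) : ℝ) ^ 2 / cfQ b (r + 1 + (n + 1)) := by
  have hmir := cfQ_mirror n r hb
  set Q := cfQ b (r + 1 + (n + 1)) with hQdef
  have hQ : (0 : ℝ) < Q := by exact_mod_cast cfQ_pos hβ.1 _
  have hA : (0 : ℝ) < cfQ a (n + 1) := by exact_mod_cast cfQ_pos hα.1 _
  have hAs : (cfQ a (n + 1) : ℝ) ≤ cfQ a (n + 1 + 1) := by exact_mod_cast cfQ_le_succ hα.1 _
  have hAn : (cfQ a n : ℝ) ≤ cfQ a (n + 1) := by exact_mod_cast cfQ_le_succ hα.1 _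
  have hBr : (cfQ b r : ℝ) ≤ cfQ b (r + 1) := by exact_mod_cast cfQ_le_succ hβ.1 _
  have hmirR : (Q : ℝ) = cfQ b (r + 1) * cfQ a (n + 1) + cfQ b r * cfQ a n := by
    exact_mod_cast hmir
  have hQle : (Q : ℝ) ≤ 2 * cfQ b (r + 1) * cfQ a (n + 1) := by
    have : (cfQ b r : ℝ) * cfQ a n ≤ cfQ b (r + 1) * cfQ a (n + 1) := by gcongr
    linarith
  have hnβ : nint (Q * β) ≤ 1 / Q := by
    refine (nint_le _ (cfP b (r + 1 + (n + 1)))).trans ?_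
    push_cast
    refine (hβ.abs_sub_le _).trans ?_
    gcongr
    exact_mod_cast cfQ_le_succ hβ.1 _
  have hnα : nint (Q * α) ≤ 2 * cfQ b (r + 1) / cfQ a (n + 1) := by
    refine (nint_le _ (cfQ b (r + 1) * cfP a (n + 1) + cfQ b r * cfP a n)).trans ?_
    push_cast
    rw [hmirR, show ((cfQ b (r + 1) : ℝ) * cfQ a (n + 1) + cfQ b r * cfQ a n) * α -
        (cfQ b (r + 1) * cfP a (n + 1) + cfQ b r * cfP a n) =
        cfQ b (r + 1) * (cfQ a (n + 1) * α - cfP a (n + 1)) +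
        cfQ b r * (cfQ a n * α - cfP a n) by ring]
    refine (abs_add_le _ _).trans ?_
    rw [abs_mul, abs_mul, Nat.abs_cast, Nat.abs_cast]
    have h1 := (hα.abs_sub_le (n + 1)).trans (one_div_le_one_div_of_le hA hAs)
    have h2 := hα.abs_sub_le n
    calc _ ≤ (cfQ b (r + 1) : ℝ) * (1 / cfQ a (n + 1)) +
          cfQ b (r + 1) * (1 / cfQ a (n + 1)) := by gcongr
      _ = _ := by ring
  calc (Q : ℝ) * nint (Q * α) * nint (Q * β)
      ≤ Q * (2 * cfQ b (r + 1) / cfQ a (n + 1)) * (1 / Q) := by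
        have : 0 ≤ nint (Q * β) := abs_nonneg _
        gcongr
    _ = 2 * cfQ b (r + 1) / cfQ a (n + 1) := by field_simp
    _ ≤ _ := by
        rw [div_le_div_iff₀ hA hQ]
        have : (0 : ℝ) ≤ 2 * cfQ b (r + 1) := by positivity
        nlinarith

end Continuants

section Blocks

/-- The index `k` of the block `(r k, r (k + 1)]` containing `i`. -/
def blockIdx (r : ℕ → ℕ) (i : ℕ) : ℕ := Nat.findGreatest (fun k => r k < i) i

lemma blockIdx_eq {r : ℕ → ℕ} (hr : StrictMono r) {i k : ℕ} (h1 : r k < i)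
    (h2 : i ≤ r (k + 1)) : blockIdx r i = k := by
  rw [blockIdx, Nat.findGreatest_eq_iff]
  refine ⟨(hr.id_le k).trans h1.le, fun _ => h1, fun n hn _ => ?_⟩
  exact not_lt.2 (h2.trans (hr.monotone hn))

/-- The word whose `k`-th block, occupying the positions `(r k, r (k + 1)]`, is the separator
`1` or `2` (according to `s k`) followed by a mirrored prefix of `f k`. -/
def mirrorWord (r : ℕ → ℕ) (f : ℕ → ℕ → ℕ) (s : ℕ → Bool) (i : ℕ) : ℕ :=
  if i = r (blockIdx r i) + 1 then (if s (blockIdx r i) then 1 else 2)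
  else f (blockIdx r i) (r (blockIdx r i + 1) - i + 1)

variable {r : ℕ → ℕ} {f : ℕ → ℕ → ℕ} {N : ℕ}

lemma one_le_mirrorWord (hf : ∀ k i, 1 ≤ i → 1 ≤ f k i) (s : ℕ → Bool) (i : ℕ) :
    1 ≤ mirrorWord r f s i := by
  unfold mirrorWord
  split_ifs
  · exact le_rfl
  · exact one_le_two
  · exact hf _ _ (by omega)

lemma mirrorWord_le (hN : 2 ≤ N) (hf : ∀ k i, 1 ≤ i → f k i ≤ N) (s : ℕ → Bool) (i : ℕ) :
    mirrorWord r f s i ≤ N := by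
  unfold mirrorWord
  split_ifs
  · omega
  · omega
  · exact hf _ _ (by omega)

lemma mirrorWord_separator (hr : StrictMono r) (s : ℕ → Bool) (k : ℕ) :
    mirrorWord r f s (r k + 1) = if s k then 1 else 2 := by
  have := blockIdx_eq hr (Nat.lt_succ_self (r k)) (hr (Nat.lt_succ_self k))
  simp [mirrorWord, this]

lemma mirrorWord_mirror (hr : StrictMono r) (s : ℕ → Bool) {k n i : ℕ}
    (hn : r (k + 1) = r k + 1 + (n + 1)) (h1 : 1 ≤ i) (h2 : i ≤ n + 1) :
    mirrorWord r f s (r k + 1 + i) = f k (n + 2 - i) := by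
  have := blockIdx_eq hr (show r k < r k + 1 + i by omega) (by omega)
  rw [mirrorWord, this, if_neg (by omega)]
  congr 1
  omega

end Blocks

lemma exists_rapid_strictMono (g : ℕ → ℕ) :
    ∃ r : ℕ → ℕ, ∀ k, r k + 2 ≤ r (k + 1) ∧ g (r k) ≤ r (k + 1) :=
  ⟨fun k => Nat.rec 0 (fun _ x => max (x + 2) (g x)) k,
    fun _ => ⟨le_max_left _ _, le_max_right _ _⟩⟩

/-- A countable set of numbers with uniformly bounded partial quotients can be covered by a
sequence of expansions, each of which occurs infinitely often. -/
lemma exists_recurrent_expansions {M : ℝ} {𝒜 : Set ℝ} (hcount : 𝒜.Countable)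
    (h𝒜 : ∀ α ∈ 𝒜, ∃ a : ℕ → ℕ, IsCF a α ∧ ∀ i, 1 ≤ i → (a i : ℝ) ≤ M) :
    ∃ (N : ℕ) (f : ℕ → ℕ → ℕ), 2 ≤ N ∧ (∀ k i, 1 ≤ i → 1 ≤ f k i) ∧
      (∀ k i, 1 ≤ i → f k i ≤ N) ∧
      ∀ α ∈ 𝒜, ∃ a, IsCF a α ∧ ∀ K, ∃ k, K ≤ k ∧ f k = a := by
  choose! c hc hcM using h𝒜
  set S : Set (ℕ → ℕ) := insert (fun _ => 1) (c '' 𝒜)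
  have hS : S.Countable := (hcount.image c).insert _
  obtain ⟨e, he⟩ := hS.exists_eq_range (Set.insert_nonempty _ _)
  have heS : ∀ k, e k ∈ S := fun k => he ▸ Set.mem_range_self k
  refine ⟨⌊M⌋₊ + 2, fun k => e k.unpair.1, by omega, fun k i hi => ?_, fun k i hi => ?_,
    fun α hα => ⟨c α, hc α hα, fun K => ?_⟩⟩
  · rcases heS k.unpair.1 with h | ⟨α, hα, h⟩
    · simp [h]
    · simpa [← h] using (hc α hα).1 i hi
  · rcases heS k.unpair.1 with h | ⟨α, hα, h⟩
    · simp [h]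
    · simpa [← h] using (Nat.le_floor (hcM α hα i hi)).trans (Nat.le_add_right _ 2)
  · obtain ⟨j, hj⟩ : c α ∈ Set.range e := he ▸ Or.inr ⟨α, hα, rfl⟩
    exact ⟨Nat.pair j K, Nat.right_le_pair j K, by simpa using hj⟩

/-- Theorem 3 of Adamczewski–Bugeaud.  Let `φ` be positive,
non-increasing with `φ 1 = 1`, `φ q → 0`, `q·φ q → ∞`.  Let `M > 0` and let
`𝒜` be a countable set of badly approximable numbers whose partial quotients
are all bounded by `M`.  Then there is an uncountable set `B` of badly
approximable numbers such that for every `α ∈ 𝒜` and `β ∈ B` there are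
infinitely many positive integers `q` with `q·‖qα‖·‖qβ‖ ≤ 1/(q·φ q)`. -/
theorem littlewood_strong_of_countable_family
    (φ : ℕ → ℝ)
    (hφpos : ∀ q, 1 ≤ q → 0 < φ q)
    (hφanti : ∀ p q, 1 ≤ p → p ≤ q → φ q ≤ φ p)
    (hφone : φ 1 = 1)
    (hφzero : Tendsto φ atTop (nhds 0))
    (hφinfty : Tendsto (fun q : ℕ => (q : ℝ) * φ q) atTop atTop)
    (M : ℝ) (hM : 0 < M)
    (𝒜 : Set ℝ) (h𝒜count : 𝒜.Countable)
    (h𝒜 : ∀ α ∈ 𝒜, IsBad α ∧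
      ∃ a : ℕ → ℕ, IsCF a α ∧ ∀ i, 1 ≤ i → (a i : ℝ) ≤ M) :
    ∃ B : Set ℝ, ¬ B.Countable ∧ (∀ β ∈ B, IsBad β) ∧
      ∀ α ∈ 𝒜, ∀ β ∈ B,
        {q : ℕ | 1 ≤ q ∧
            (q : ℝ) * nint ((q : ℝ) * α) * nint ((q : ℝ) * β)
              ≤ 1 / ((q : ℝ) * φ q)}.Infinite := by
  obtain ⟨N, f, hN, hf1, hfN, hf⟩ :=
    exists_recurrent_expansions h𝒜count fun α hα => (h𝒜 α hα).2
  have hg : ∀ x : ℕ, ∃ m₀ : ℕ, ∀ m, m₀ ≤ m → 4 * (((N : ℝ) + 1) ^ (x + 1)) ^ 2 * φ m ≤ 1 := by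
    intro x
    have h := hφzero.const_mul (4 * (((N : ℝ) + 1) ^ (x + 1)) ^ 2)
    rw [mul_zero] at h
    exact eventually_atTop.1 (h.eventually_le_const one_pos)
  choose g hg using hg
  obtain ⟨r, hr⟩ := exists_rapid_strictMono g
  have hrm : StrictMono r := strictMono_nat_of_lt_succ fun k => by have := (hr k).1; omega
  set b : (ℕ → Bool) → ℕ → ℕ := mirrorWord r f with hbdef
  have hb1 : ∀ s i, 1 ≤ i → 1 ≤ b s i := fun s i _ => one_le_mirrorWord hf1 s i
  have hbN : ∀ s i, 1 ≤ i → b s i ≤ N := fun s i _ => mirrorWord_le hN hfN s i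
  choose β hβ using fun s => exists_isCF (hb1 s)
  have hinj : Function.Injective β := by
    intro s t hst
    funext k
    have h := (hβ s).unique (hst ▸ hβ t) (r k)
    rw [hbdef, mirrorWord_separator hrm, mirrorWord_separator hrm] at h
    cases hs : s k <;> cases ht : t k <;> simp [hs, ht] at h ⊢
  refine ⟨Set.range β, fun hcount => ?_, ?_, ?_⟩
  · have : Countable (ℕ → Bool) := by
      have := hcount.to_subtype
      exact (Set.rangeFactorization_injective.2 hinj).countable
    obtain ⟨e, he⟩ := exists_surjective_nat (ℕ → Bool)
    obtain ⟨n, hn⟩ := he fun n => !e n n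
    simpa using congrFun hn n
  · rintro _ ⟨s, rfl⟩
    exact (hβ s).isBad (hbN s)
  · rintro α hα _ ⟨s, rfl⟩
    obtain ⟨a, ha, hrec⟩ := hf α hα
    refine Set.infinite_of_forall_exists_gt fun K => ?_
    obtain ⟨k, hKk, rfl⟩ := hrec K
    obtain ⟨n, hn⟩ := Nat.exists_eq_add_of_le (hr k).1
    replace hn : r (k + 1) = r k + 1 + (n + 1) := by omega
    have hlarge : r (k + 1) ≤ cfQ (b s) (r (k + 1)) := le_cfQ (hb1 s) _
    have hk : k + 1 ≤ r (k + 1) := hrm.id_le _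
    refine ⟨cfQ (b s) (r (k + 1)), ⟨by omega, ?_⟩, by omega⟩
    have h := ha.mul_nint_mul_nint_le (hβ s) n (r k)
      fun i h1 h2 => mirrorWord_mirror hrm s hn h1 h2
    rw [← hn] at h
    refine h.trans ?_
    have hQ : (0 : ℝ) < cfQ (b s) (r (k + 1)) := by exact_mod_cast cfQ_pos (hb1 s) _
    have hφQ := hφpos (cfQ (b s) (r (k + 1))) (by omega)
    have hpow : (cfQ (b s) (r k + 1) : ℝ) ≤ ((N : ℝ) + 1) ^ (r k + 1) := by
      exact_mod_cast cfQ_le_pow (hb1 s) (hbN s) _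
    have hle : 4 * (cfQ (b s) (r k + 1) : ℝ) ^ 2 * φ (cfQ (b s) (r (k + 1))) ≤ 1 :=
      le_trans (by gcongr) (hg (r k) _ ((hr k).2.trans hlarge))
    rw [div_le_div_iff₀ hQ (by positivity)]
    nlinarith
end

section
/- Let α be an irrational real number that is not quadratic over the rationals, and let β = (aα + b)/(cα + d) with integers a, b, c, d and |ad − bc| = 1 (so that β is equivalent to α). Then 1, α, β are linearly dependent over the rationals if and only if there exists an integer m with β = α + m or β = −α + m. In particular, for any non-quadratic irrational α, the numbers 1, α, 1/α are linearly independent over the rationals. -/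
open Filter Topology

/-- Linear independence over `ℚ` of three reals `1, x, y`, in coordinates. -/
lemma linearIndependent_one_pair_iff (x y : ℝ) :
    LinearIndependent ℚ ![1, x, y] ↔
      ∀ r s t : ℚ, (r : ℝ) + s * x + t * y = 0 → r = 0 ∧ s = 0 ∧ t = 0 := by
  rw [Fintype.linearIndependent_iff]
  constructor
  · intro h r s t hrst
    have key := h ![r, s, t] (by simpa [Fin.sum_univ_three, Rat.smul_def] using hrst)
    exact ⟨key 0, key 1, key 2⟩
  · intro h g hg
    obtain ⟨h0, h1, h2⟩ := h (g 0) (g 1) (g 2)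
      (by simpa [Fin.sum_univ_three, Rat.smul_def] using hg)
    intro i
    fin_cases i <;> assumption

/-- An irrational number that is not quadratic satisfies no nontrivial rational relation of
degree at most two. -/
lemma Irrational.coeffs_eq_zero_of_not_quadratic {α : ℝ} (hirr : Irrational α)
    (hnq : ¬ ∃ p q r : ℚ, p ≠ 0 ∧ (p : ℝ) * α ^ 2 + (q : ℝ) * α + (r : ℝ) = 0)
    {p q r : ℚ} (h : (p : ℝ) * α ^ 2 + (q : ℝ) * α + (r : ℝ) = 0) :
    p = 0 ∧ q = 0 ∧ r = 0 := by
  have hp : p = 0 := by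
    by_contra hp
    exact hnq ⟨p, q, r, hp, h⟩
  subst hp
  have hq : q = 0 := by
    by_contra hq
    have hq' : (q : ℝ) ≠ 0 := by exact_mod_cast hq
    refine hirr ⟨-r / q, ?_⟩
    push_cast
    rw [div_eq_iff hq']
    push_cast at h
    linarith
  subst hq
  exact ⟨rfl, rfl, by simpa using h⟩

/-- Let `α` be irrational and not quadratic over `ℚ`, and
let `β = (aα + b)/(cα + d)` with integers `a, b, c, d` and `|ad - bc| = 1`
(so `β` is equivalent to `α`).  Then `1, α, β` are linearly dependent over the
rationals iff `β = α + m` or `β = -α + m` for some integer `m`.  In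
particular, `1, α, 1/α` are linearly independent over the rationals. -/
theorem dependent_iff_translate_of_equivalent
    (α : ℝ) (hirr : Irrational α)
    (hnq : ¬ ∃ p q r : ℚ, p ≠ 0 ∧ (p : ℝ) * α ^ 2 + (q : ℝ) * α + (r : ℝ) = 0)
    (β : ℝ) (a b c d : ℤ) (hdet : (a * d - b * c).natAbs = 1)
    (hβ : β = ((a : ℝ) * α + b) / ((c : ℝ) * α + d)) :
    ((¬ LinearIndependent ℚ ![1, α, β]) ↔
      ∃ m : ℤ, β = α + m ∨ β = -α + m) ∧
    LinearIndependent ℚ ![1, α, α⁻¹] := by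
  have hquad {p q r : ℚ} (h : (p : ℝ) * α ^ 2 + (q : ℝ) * α + (r : ℝ) = 0) :=
    hirr.coeffs_eq_zero_of_not_quadratic hnq h
  refine ⟨⟨fun hdep => ?_, ?_⟩, ?_⟩
  · have hdet' : a * d - b * c = 1 ∨ a * d - b * c = -1 := Int.natAbs_eq_iff.mp hdet
    have hden : (c : ℝ) * α + d ≠ 0 := by
      intro h
      obtain ⟨-, hc, hd⟩ := hquad (p := 0) (q := c) (r := d) (by push_cast; linarith)
      norm_cast at hc hd
      subst hc hd
      simp at hdet
    have hc : c = 0 := by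
      by_contra hc
      refine hdep ((linearIndependent_one_pair_iff α β).mpr fun r s t h => ?_)
      have hβ' : β * (c * α + d) = a * α + b := by rw [hβ, div_mul_cancel₀ _ hden]
      obtain ⟨h2, h1, h0⟩ := hquad (p := s * c) (q := r * c + s * d + t * a) (r := r * d + t * b)
        (by push_cast; linear_combination (c * α + d) * h - t * hβ')
      have hcQ : (c : ℚ) ≠ 0 := by exact_mod_cast hc
      have hs : s = 0 := (mul_eq_zero.mp h2).resolve_right hcQ
      subst hs
      have hD : (a * d - b * c : ℚ) ≠ 0 := by
        rcases hdet' with h | h <;> · norm_cast; omega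
      have hr : r * (a * d - b * c : ℚ) = 0 := by linear_combination a * h0 - b * h1
      have ht : t * (a * d - b * c : ℚ) = 0 := by linear_combination d * h1 - c * h0
      exact ⟨(mul_eq_zero.mp hr).resolve_right hD, rfl, (mul_eq_zero.mp ht).resolve_right hD⟩
    subst hc
    have had : a * d = 1 ∨ a * d = -1 := by simpa using hdet'
    rcases had with h | h
    · rcases Int.mul_eq_one_iff_eq_one_or_neg_one.mp h with ⟨rfl, rfl⟩ | ⟨rfl, rfl⟩
      · exact ⟨b, Or.inl (by rw [hβ]; simp)⟩
      · exact ⟨-b, Or.inl (by rw [hβ]; push_cast; ring)⟩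
    · rcases Int.mul_eq_neg_one_iff_eq_one_or_neg_one.mp h with ⟨rfl, rfl⟩ | ⟨rfl, rfl⟩
      · exact ⟨-b, Or.inr (by rw [hβ]; push_cast; ring)⟩
      · exact ⟨b, Or.inr (by rw [hβ]; simp)⟩
  · rintro ⟨m, hm | hm⟩ hind
    · have key := (linearIndependent_one_pair_iff α β).mp hind m 1 (-1)
        (by rw [hm]; push_cast; ring)
      exact one_ne_zero key.2.1
    · have key := (linearIndependent_one_pair_iff α β).mp hind (-m) 1 1
        (by rw [hm]; push_cast; ring)
      exact one_ne_zero key.2.1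
  · refine (linearIndependent_one_pair_iff α α⁻¹).mpr fun r s t h => ?_
    have hα : α * α⁻¹ = 1 := mul_inv_cancel₀ hirr.ne_zero
    obtain ⟨hs, hr, ht⟩ := hquad (p := s) (q := r) (r := t)
      (by linear_combination α * h - t * hα)
    exact ⟨hr, hs, ht⟩
end
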